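/- Let G be a gem-free graph with odd size m ≥ 23, no isolated vertices, and G ≇ S_{(m+3)/2,2}. Then ρ(G) ≤ ρ(S^2_{(m+5)/2,2}), with equality if and only if G ≅ S^2_{(m+5)/2,2}. -/

import Mathlib

open scoped Classical
open SimpleGraph Matrix

def ContainsCopy {α β : Type*} (H : SimpleGraph α) (G : SimpleGraph β) : Prop :=
  ∃ f : α ↪ β, ∀ a b, H.Adj a b → G.Adj (f a) (f b)

def gem : SimpleGraph (Fin 5) :=
  SimpleGraph.fromRel (fun a b => (b.val = a.val + 1 ∧ b.val ≤ 3) ∨ b = 4)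

def bookS (k : ℕ) : SimpleGraph (Fin 2 ⊕ Fin k) :=
  SimpleGraph.fromRel (fun a _ => a.isLeft = true)

def pendantS (s t : ℕ) : SimpleGraph (Fin 2 ⊕ (Fin s ⊕ Fin t)) :=
  SimpleGraph.fromRel (fun a b =>
    match a, b with
    | Sum.inl _, Sum.inl _ => True
    | Sum.inl _, Sum.inr (Sum.inl _) => True
    | Sum.inl i, Sum.inr (Sum.inr _) => i = 0
    | _, _ => False)

def starG (r : ℕ) : SimpleGraph (Fin (r + 1)) :=
  SimpleGraph.fromRel (fun a _ => a = 0)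

noncomputable def specRad {V : Type*} [Fintype V] (G : SimpleGraph V) : ℝ :=
  sSup {μ : ℝ | Module.End.HasEigenvalue (Matrix.mulVecLin (G.adjMatrix ℝ)) μ}

noncomputable def edgeCount {V : Type*} [Fintype V] (G : SimpleGraph V) : ℕ :=
  G.edgeFinset.card

noncomputable def edgesIn {V : Type*} [Fintype V] (G : SimpleGraph V) (S : Finset V) : ℕ :=
  (G.edgeFinset.filter (fun e => ∀ v ∈ e, v ∈ S)).card

noncomputable def N0 {V : Type*} [Fintype V] (G : SimpleGraph V) (u : V) : Finset V :=
  (G.neighborFinset u).filter (fun v => ∀ w ∈ G.neighborFinset u, ¬ G.Adj v w)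

noncomputable def Nplus {V : Type*} [Fintype V] (G : SimpleGraph V) (u : V) : Finset V :=
  G.neighborFinset u \ N0 G u

noncomputable def Wset {V : Type*} [Fintype V] (G : SimpleGraph V) (u : V) : Finset V :=
  Finset.univ \ insert u (G.neighborFinset u)

def InFamily (m : ℕ) {V : Type*} [Fintype V] (G : SimpleGraph V) : Prop :=
  ¬ ContainsCopy gem G ∧ edgeCount G = m ∧ (∀ v : V, ∃ w, G.Adj v w) ∧
    ¬ Nonempty (G ≃g bookS ((m - 1) / 2))

def MaxInFamily (m : ℕ) {V : Type*} [Fintype V] (G : SimpleGraph V) : Prop :=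
  InFamily m G ∧ ∀ (n : ℕ) (H : SimpleGraph (Fin n)), InFamily m H → specRad H ≤ specRad G

def IsCutVertex {V : Type*} (G : SimpleGraph V) (v : V) : Prop :=
  ∃ a b : {x : V // x ≠ v}, G.Reachable a.1 b.1 ∧
    ¬ (G.induce {x : V | x ≠ v}).Reachable a b

lemma finite_setOf_hasEigenvalue_adjMatrix {V : Type*} [Fintype V] (G : SimpleGraph V) :
    {μ : ℝ | Module.End.HasEigenvalue (Matrix.mulVecLin (G.adjMatrix ℝ)) μ}.Finite :=
  Module.End.finite_hasEigenvalue _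

lemma hasEigenvalue_of_mulVec_eq {V : Type*} [Fintype V] {A : Matrix V V ℝ} {μ : ℝ} {x : V → ℝ}
    (hx : x ≠ 0) (h : A *ᵥ x = μ • x) : Module.End.HasEigenvalue (Matrix.mulVecLin A) μ :=
  Module.End.hasEigenvalue_of_hasEigenvector (x := x)
    ⟨Module.End.mem_eigenspace_iff.2 (by simpa using h), hx⟩

lemma le_specRad {V : Type*} [Fintype V] (G : SimpleGraph V) {μ : ℝ} {x : V → ℝ}
    (hx : x ≠ 0) (h : G.adjMatrix ℝ *ᵥ x = μ • x) : μ ≤ specRad G :=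
  le_csSup (finite_setOf_hasEigenvalue_adjMatrix G).bddAbove (hasEigenvalue_of_mulVec_eq hx h)

lemma exists_mulVec_eq_specRad_smul {V : Type*} [Fintype V] [Nonempty V] (G : SimpleGraph V) :
    ∃ x : V → ℝ, x ≠ 0 ∧ G.adjMatrix ℝ *ᵥ x = specRad G • x := by
  have hA : (G.adjMatrix ℝ).IsHermitian := by
    rw [Matrix.IsHermitian, Matrix.conjTranspose_eq_transpose_of_trivial, transpose_adjMatrix]
  have hne : {μ : ℝ | Module.End.HasEigenvalue (Matrix.mulVecLin (G.adjMatrix ℝ)) μ}.Nonempty := by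
    let i : V := Classical.arbitrary V
    refine ⟨hA.eigenvalues i, hasEigenvalue_of_mulVec_eq (x := ⇑(hA.eigenvectorBasis i)) ?_
      (hA.mulVec_eigenvectorBasis i)⟩
    intro h0
    exact hA.eigenvectorBasis.orthonormal.ne_zero i (by ext j; exact congrFun h0 j)
  have hmem := hne.csSup_mem (finite_setOf_hasEigenvalue_adjMatrix G)
  obtain ⟨x, hx⟩ := Module.End.HasEigenvalue.exists_hasEigenvector hmem
  exact ⟨x, hx.2, Module.End.mem_eigenspace_iff.1 hx.1⟩

lemma posSemidef_specRad_sub_adjMatrix {V : Type*} [Fintype V] (G : SimpleGraph V) :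
    (specRad G • (1 : Matrix V V ℝ) - G.adjMatrix ℝ).PosSemidef := by
  have hA : (specRad G • (1 : Matrix V V ℝ) - G.adjMatrix ℝ).IsHermitian := by
    rw [Matrix.IsHermitian, Matrix.conjTranspose_eq_transpose_of_trivial]
    simp
  refine hA.posSemidef_iff_eigenvalues_nonneg.2 fun i => ?_
  have h := hA.mulVec_eigenvectorBasis i
  have h0 : (⇑(hA.eigenvectorBasis i) : V → ℝ) ≠ 0 := fun h0 =>
    hA.eigenvectorBasis.orthonormal.ne_zero i (by ext j; exact congrFun h0 j)
  have h1 : G.adjMatrix ℝ *ᵥ ⇑(hA.eigenvectorBasis i)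
      = (specRad G - hA.eigenvalues i) • ⇑(hA.eigenvectorBasis i) := by
    rw [Matrix.sub_mulVec, Matrix.smul_mulVec, Matrix.one_mulVec] at h
    rw [sub_smul, ← h]
    abel
  have := le_specRad G h0 h1
  simp only [Pi.zero_apply]
  linarith

lemma exists_perron_vector {V : Type*} [Fintype V] [Nonempty V] (G : SimpleGraph V) :
    ∃ (x : V → ℝ) (u : V), (∀ v, 0 ≤ x v) ∧ (∀ v, x v ≤ 1) ∧ x u = 1 ∧
      ∀ v, specRad G * x v = ∑ w ∈ G.neighborFinset v, x w := by
  obtain ⟨y, hy0, hy⟩ := exists_mulVec_eq_specRad_smul G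
  have hM := posSemidef_specRad_sub_adjMatrix G
  set M := specRad G • (1 : Matrix V V ℝ) - G.adjMatrix ℝ with hMdef
  have hquad : ∀ z : V → ℝ, z ⬝ᵥ (M *ᵥ z)
      = specRad G * ∑ v, z v * z v - ∑ v, ∑ w ∈ G.neighborFinset v, z v * z w := by
    intro z
    rw [hMdef, Matrix.sub_mulVec, Matrix.smul_mulVec, Matrix.one_mulVec, dotProduct_sub,
      dotProduct_smul]
    simp [dotProduct, Finset.mul_sum]
  have hMy : M *ᵥ y = 0 := by
    rw [hMdef, Matrix.sub_mulVec, Matrix.smul_mulVec, Matrix.one_mulVec, hy, sub_self]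
  have habs : M *ᵥ |y| = 0 := by
    refine (hM.dotProduct_mulVec_zero_iff |y|).1 (le_antisymm ?_ (hM.dotProduct_mulVec_nonneg _))
    have h0 : y ⬝ᵥ (M *ᵥ y) = 0 := by rw [hMy, dotProduct_zero]
    rw [star_trivial, ← h0, hquad, hquad]
    simp only [Pi.abs_apply, abs_mul_abs_self]
    refine sub_le_sub_left (Finset.sum_le_sum fun v _ => Finset.sum_le_sum fun w _ => ?_) _
    rw [← abs_mul]
    exact le_abs_self _
  have heig : ∀ v, specRad G * |y v| = ∑ w ∈ G.neighborFinset v, |y w| := by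
    intro v
    have := congrFun habs v
    rw [hMdef, Matrix.sub_mulVec, Matrix.smul_mulVec, Matrix.one_mulVec] at this
    simpa [sub_eq_zero] using this
  obtain ⟨u, hu⟩ := Finite.exists_max fun v => |y v|
  have hpos : 0 < |y u| := by
    obtain ⟨v, hv⟩ := Function.ne_iff.1 hy0
    exact (abs_pos.2 hv).trans_le (hu v)
  refine ⟨fun v => |y v| / |y u|, u, fun v => by positivity, fun v => (div_le_one hpos).2 (hu v),
    div_self hpos.ne', fun v => ?_⟩
  rw [← Finset.sum_div, ← heig, mul_div_assoc]

lemma hasEigenvalue_adjMatrix_of_iso {V W : Type*} [Fintype V] [Fintype W] {G : SimpleGraph V}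
    {H : SimpleGraph W} (e : G ≃g H) {μ : ℝ}
    (h : Module.End.HasEigenvalue (Matrix.mulVecLin (G.adjMatrix ℝ)) μ) :
    Module.End.HasEigenvalue (Matrix.mulVecLin (H.adjMatrix ℝ)) μ := by
  obtain ⟨x, hx⟩ := h.exists_hasEigenvector
  have hx1 : G.adjMatrix ℝ *ᵥ x = μ • x := Module.End.mem_eigenspace_iff.1 hx.1
  refine hasEigenvalue_of_mulVec_eq (x := fun w => x (e.symm w)) ?_ ?_
  · intro h0
    apply hx.2
    ext v
    simpa using congrFun h0 (e v)
  · ext w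
    have h1 := congrFun hx1 (e.symm w)
    rw [adjMatrix_mulVec_apply] at h1 ⊢
    rw [Pi.smul_apply] at h1 ⊢
    rw [← h1]
    refine Finset.sum_bij' (fun a _ => e.symm a) (fun a _ => e a) ?_ ?_ ?_ ?_ ?_
    · intro a ha
      simpa [e.symm.map_adj_iff] using ha
    · intro a ha
      rw [mem_neighborFinset] at ha ⊢
      rwa [← e.symm.map_adj_iff, e.symm_apply_apply]
    all_goals simp

lemma specRad_congr {V W : Type*} [Fintype V] [Fintype W] {G : SimpleGraph V} {H : SimpleGraph W}
    (e : G ≃g H) : specRad G = specRad H := by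
  unfold specRad
  congr 1
  ext μ
  exact ⟨hasEigenvalue_adjMatrix_of_iso e, hasEigenvalue_adjMatrix_of_iso e.symm⟩

lemma neighborFinset_pendantS_zero (s t : ℕ) :
    (pendantS s t).neighborFinset (Sum.inl 0) = insert (Sum.inl 1) (Finset.univ.map .inr) := by
  ext v
  rw [mem_neighborFinset]
  rcases v with i | j | k
  · fin_cases i <;> simp [pendantS]
  · simp [pendantS]
  · simp [pendantS]

lemma neighborFinset_pendantS_one (s t : ℕ) :
    (pendantS s t).neighborFinset (Sum.inl 1)
      = insert (Sum.inl 0) ((Finset.univ.map .inl).map .inr) := by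
  ext v
  rw [mem_neighborFinset]
  rcases v with i | j | k
  · fin_cases i <;> simp [pendantS]
  · simp [pendantS]
  · simp [pendantS]

lemma neighborFinset_pendantS_inr_inl (s t : ℕ) (j : Fin s) :
    (pendantS s t).neighborFinset (Sum.inr (Sum.inl j)) = {Sum.inl 0, Sum.inl 1} := by
  ext v
  rw [mem_neighborFinset]
  rcases v with i | j | k
  · fin_cases i <;> simp [pendantS]
  · simp [pendantS]
  · simp [pendantS]

lemma neighborFinset_pendantS_inr_inr (s t : ℕ) (k : Fin t) :
    (pendantS s t).neighborFinset (Sum.inr (Sum.inr k)) = {Sum.inl 0} := by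
  ext v
  rw [mem_neighborFinset]
  rcases v with i | j | k
  · fin_cases i <;> simp [pendantS]
  · simp [pendantS]
  · simp [pendantS]

lemma le_specRad_pendantS_two (s : ℕ) {μ : ℝ} (hμ : 0 < μ)
    (h : μ ^ 4 - (2 * s + 3) * μ ^ 2 - 2 * s * μ + 2 * s = 0) :
    μ ≤ specRad (pendantS s 2) := by
  let x : Fin 2 ⊕ (Fin s ⊕ Fin 2) → ℝ :=
    Sum.elim ![μ * (μ ^ 2 - s), μ * (μ + s)]
      (Sum.elim (fun _ => μ ^ 2 + μ) fun _ => μ ^ 2 - s)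
  refine le_specRad _ (x := x) ?_ ?_
  · intro h0
    have := congrFun h0 (Sum.inl 1)
    have hpos : 0 < μ * (μ + s) := by positivity
    exact hpos.ne' this
  · ext v
    rw [adjMatrix_mulVec_apply]
    rcases v with i | j | k
    · fin_cases i
      · simp [neighborFinset_pendantS_zero, x]
        linear_combination -h
      · simp [neighborFinset_pendantS_one, x]
        ring
    · simp [neighborFinset_pendantS_inr_inl, x]
      ring
    · simp [neighborFinset_pendantS_inr_inr, x]

lemma exists_root_le_specRad_pendantS_two {s : ℕ} (hs : 10 ≤ s) :
    ∃ μ : ℝ, μ ≤ specRad (pendantS s 2) ∧ 5 < μ ∧ 2 * s + 1 < μ ^ 2 - μ ∧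
      μ ^ 4 - (2 * s + 3) * μ ^ 2 - 2 * s * μ + 2 * s = 0 := by
  have hs' : (10 : ℝ) ≤ s := by exact_mod_cast hs
  obtain ⟨a, ha0, ha⟩ : ∃ a : ℝ, 0 < a ∧ a ^ 2 - a = 2 * s + 1 := by
    refine ⟨(1 + √(8 * s + 5)) / 2, by positivity, ?_⟩
    have := Real.sq_sqrt (show (0 : ℝ) ≤ 8 * s + 5 by positivity)
    linear_combination this / 4
  have ha5 : 5 < a := by nlinarith
  have has : a ≤ 2 * s := by nlinarith
  let f : ℝ → ℝ := fun μ => μ ^ 4 - (2 * s + 3) * μ ^ 2 - 2 * s * μ + 2 * s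
  have hfa : f a = -1 := by
    simp only [f]
    have hsa : (s : ℝ) = (a ^ 2 - a - 1) / 2 := by linarith
    rw [hsa]
    ring
  have hfb : 0 ≤ f (2 * s) := by
    simp only [f]
    have : (0 : ℝ) ≤ s * s * (16 * s * s - 8 * s - 16) := by
      have : (0 : ℝ) ≤ 16 * s * s - 8 * s - 16 := by nlinarith
      positivity
    nlinarith
  obtain ⟨μ, ⟨hμa, hμb⟩, hμ⟩ := intermediate_value_Icc has
    (f := f) (by fun_prop) ⟨by rw [hfa]; norm_num, hfb⟩
  have hne : a ≠ μ := by
    rintro rfl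
    rw [hfa] at hμ
    norm_num at hμ
  have hlt : a < μ := lt_of_le_of_ne hμa hne
  exact ⟨μ, le_specRad_pendantS_two s (by linarith) hμ, by linarith, by nlinarith, hμ⟩

lemma pendantS_zero_iso_bookS (s : ℕ) : Nonempty (pendantS s 0 ≃g bookS s) := by
  refine ⟨⟨(Equiv.refl _).sumCongr (Equiv.sumEmpty _ _), ?_⟩⟩
  rintro (a | a | a) (b | b | b)
  all_goals first
    | exact Fin.elim0 a
    | exact Fin.elim0 b
    | simp [pendantS, bookS]

lemma nonempty_iso_pendantS {V : Type*} [Fintype V] {G : SimpleGraph V} {u c : V}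
    {L P : Finset V} (hcover : ∀ v, v = u ∨ v = c ∨ v ∈ L ∨ v ∈ P) (huc : G.Adj u c)
    (huL : ∀ l ∈ L, G.Adj u l) (hcL : ∀ l ∈ L, G.Adj c l) (huP : ∀ p ∈ P, G.Adj u p)
    (hcP : ∀ p ∈ P, ¬ G.Adj c p) (hcPne : c ∉ P) (hLL : ∀ l ∈ L, ∀ l' ∈ L, ¬ G.Adj l l')
    (hLP : ∀ l ∈ L, ∀ p ∈ P, ¬ G.Adj l p) (hPP : ∀ p ∈ P, ∀ p' ∈ P, ¬ G.Adj p p') :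
    Nonempty (G ≃g pendantS L.card P.card) := by
  let f : Fin 2 ⊕ (Fin L.card ⊕ Fin P.card) → V :=
    Sum.elim ![u, c] (Sum.elim (fun i => L.equivFin.symm i) fun i => P.equivFin.symm i)
  have hLmem (i : Fin L.card) : (L.equivFin.symm i : V) ∈ L := (L.equivFin.symm i).2
  have hPmem (i : Fin P.card) : (P.equivFin.symm i : V) ∈ P := (P.equivFin.symm i).2
  have huL' : u ∉ L := fun h => (huL u h).ne rfl
  have hcL' : c ∉ L := fun h => (hcL c h).ne rfl
  have huP' : u ∉ P := fun h => (huP u h).ne rfl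
  have hdisj : ∀ v ∈ L, v ∉ P := fun v h h' => hcP v h' (hcL v h)
  have hinj : Function.Injective f := by
    rintro (a | a | a) (b | b | b) hab
    · fin_cases a <;> fin_cases b <;> simp [f, huc.ne, huc.ne'] at hab ⊢
    · fin_cases a
      · exact absurd hab (ne_of_mem_of_not_mem (hLmem b) huL').symm
      · exact absurd hab (ne_of_mem_of_not_mem (hLmem b) hcL').symm
    · fin_cases a
      · exact absurd hab (ne_of_mem_of_not_mem (hPmem b) huP').symm
      · exact absurd hab (ne_of_mem_of_not_mem (hPmem b) hcPne).symm
    · fin_cases b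
      · exact absurd hab (ne_of_mem_of_not_mem (hLmem a) huL')
      · exact absurd hab (ne_of_mem_of_not_mem (hLmem a) hcL')
    · simpa [f, Subtype.coe_inj] using hab
    · exact absurd hab (ne_of_mem_of_not_mem (hPmem b) (hdisj _ (hLmem a))).symm
    · fin_cases b
      · exact absurd hab (ne_of_mem_of_not_mem (hPmem a) huP')
      · exact absurd hab (ne_of_mem_of_not_mem (hPmem a) hcPne)
    · exact absurd hab (ne_of_mem_of_not_mem (hPmem a) (hdisj _ (hLmem b)))
    · simpa [f, Subtype.coe_inj] using hab
  have hsurj : Function.Surjective f := by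
    intro v
    rcases hcover v with rfl | rfl | h | h
    · exact ⟨Sum.inl 0, rfl⟩
    · exact ⟨Sum.inl 1, rfl⟩
    · exact ⟨Sum.inr (Sum.inl (L.equivFin ⟨v, h⟩)), by simp [f]⟩
    · exact ⟨Sum.inr (Sum.inr (P.equivFin ⟨v, h⟩)), by simp [f]⟩
  suffices hadj : ∀ a b, G.Adj (f a) (f b) ↔ (pendantS L.card P.card).Adj a b from
    ⟨Iso.symm ⟨Equiv.ofBijective f ⟨hinj, hsurj⟩, hadj _ _⟩⟩
  have hL1 := fun i => huL _ (hLmem i)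
  have hL2 := fun i => hcL _ (hLmem i)
  have hP1 := fun i => huP _ (hPmem i)
  have hP2 := fun i => hcP _ (hPmem i)
  have hLL' := fun i j => hLL _ (hLmem i) _ (hLmem j)
  have hLP' := fun i j => hLP _ (hLmem i) _ (hPmem j)
  have hPP' := fun i j => hPP _ (hPmem i) _ (hPmem j)
  have hPL' (i j) : ¬ G.Adj (P.equivFin.symm i : V) (L.equivFin.symm j) :=
    fun h => hLP' j i h.symm
  have hP2' (i) : ¬ G.Adj (P.equivFin.symm i : V) c := fun h => hP2 i h.symm
  rintro (a | a | a) (b | b | b)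
  · fin_cases a <;> fin_cases b <;> simp [f, pendantS, huc, huc.symm]
  · fin_cases a <;> simp [f, pendantS, hL1, hL2]
  · fin_cases a <;> simp [f, pendantS, hP1, hP2]
  · fin_cases b <;> simp [f, pendantS, fun i => (hL1 i).symm, fun i => (hL2 i).symm]
  · simp [f, pendantS, hLL']
  · simp [f, pendantS, hLP']
  · fin_cases b <;> simp [f, pendantS, fun i => (hP1 i).symm, hP2']
  · simp [f, pendantS, hPL']
  · simp [f, pendantS, hPP']

lemma false_of_gemFree {V : Type*} {G : SimpleGraph V} (hgf : ¬ ContainsCopy gem G)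
    {u a b c d : V} (ha : G.Adj u a) (hb : G.Adj u b) (hc : G.Adj u c) (hd : G.Adj u d)
    (hab : G.Adj a b) (hbc : G.Adj b c) (hcd : G.Adj c d) (hac : a ≠ c) (had : a ≠ d)
    (hbd : b ≠ d) : False := by
  have key : ∀ i j, gem.Adj i j → G.Adj (![a, b, c, d, u] i) (![a, b, c, d, u] j) := by
    intro i j hij
    fin_cases i <;> fin_cases j <;>
      simp_all [gem, ha.symm, hb.symm, hc.symm, hd.symm, hab.symm, hbc.symm, hcd.symm]
  refine hgf ⟨⟨![a, b, c, d, u], ?_⟩, key⟩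
  intro i j hij
  fin_cases i <;> fin_cases j <;>
    simp_all [ha.ne, ha.ne', hb.ne, hb.ne', hc.ne, hc.ne', hd.ne, hd.ne', hab.ne, hab.ne',
      hbc.ne, hbc.ne', hcd.ne, hcd.ne', hac.symm, had.symm, hbd.symm]

/-- The number of neighbours of `v` inside `S`. -/
noncomputable def degIn {V : Type*} (G : SimpleGraph V) (S : Finset V) (v : V) : ℕ :=
  (S.filter (G.Adj v)).card

/-- `S` contains no path on four vertices. -/
def PathFourFree {V : Type*} (G : SimpleGraph V) (S : Finset V) : Prop :=
  ∀ ⦃a⦄, a ∈ S → ∀ ⦃b⦄, b ∈ S → ∀ ⦃c⦄, c ∈ S → ∀ ⦃d⦄, d ∈ S →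
    G.Adj a b → G.Adj b c → G.Adj c d → a ≠ c → a ≠ d → b ≠ d → False

/-- The vertices of `S` lying on a triangle inside `S`. -/
noncomputable def triangleVerts {V : Type*} (G : SimpleGraph V) (S : Finset V) : Finset V :=
  S.filter fun w => ∃ a ∈ S, ∃ b ∈ S, G.Adj w a ∧ G.Adj w b ∧ G.Adj a b

section PathFourFree

variable {V : Type*} {G : SimpleGraph V} {S : Finset V}

lemma pathFourFree_neighborFinset [Fintype V] (hgf : ¬ ContainsCopy gem G) (u : V) :
    PathFourFree G (G.neighborFinset u) := by
  intro a ha b hb c hc d hd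
  rw [mem_neighborFinset] at ha hb hc hd
  exact false_of_gemFree hgf ha hb hc hd

lemma exists_adj_ne_of_two_le_degIn {w : V} (v : V) (h : 2 ≤ degIn G S w) :
    ∃ v' ∈ S, G.Adj w v' ∧ v' ≠ v := by
  obtain ⟨v', hv', hne⟩ := Finset.exists_mem_ne (show 1 < _ from h) v
  rw [Finset.mem_filter] at hv'
  exact ⟨v', hv'.1, hv'.2, hne⟩

lemma degIn_pos_iff {w : V} : 0 < degIn G S w ↔ ∃ v ∈ S, G.Adj w v := by
  simp [degIn, Finset.card_pos, Finset.Nonempty]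

lemma filter_adj_of_mem_triangleVerts (hP : PathFourFree G S) {w : V}
    (hw : w ∈ triangleVerts G S) :
    ∃ a ∈ S, ∃ b ∈ S, G.Adj w a ∧ G.Adj w b ∧ G.Adj a b ∧ S.filter (G.Adj w) = {a, b} := by
  obtain ⟨hwS, a, ha, b, hb, hwa, hwb, hab⟩ := Finset.mem_filter.1 hw
  refine ⟨a, ha, b, hb, hwa, hwb, hab, ?_⟩
  ext y
  simp only [Finset.mem_filter, Finset.mem_insert, Finset.mem_singleton]
  refine ⟨fun ⟨hy, hwy⟩ => ?_, ?_⟩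
  · by_contra! h
    exact hP hy hwS ha hb hwy.symm hwa hab h.1 h.2 hwb.ne
  · rintro (rfl | rfl)
    exacts [⟨ha, hwa⟩, ⟨hb, hwb⟩]

lemma degIn_of_mem_triangleVerts (hP : PathFourFree G S) {w : V} (hw : w ∈ triangleVerts G S) :
    degIn G S w = 2 := by
  obtain ⟨a, _, b, _, _, _, hab, h⟩ := filter_adj_of_mem_triangleVerts hP hw
  rw [degIn, h, Finset.card_pair hab.ne]

lemma mem_triangleVerts_of_adj (hP : PathFourFree G S) {w v : V} (hw : w ∈ triangleVerts G S)
    (hv : v ∈ S) (hwv : G.Adj w v) : v ∈ triangleVerts G S := by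
  obtain ⟨a, ha, b, hb, hwa, hwb, hab, h⟩ := filter_adj_of_mem_triangleVerts hP hw
  have hwS := (Finset.mem_filter.1 hw).1
  have : v ∈ S.filter (G.Adj w) := Finset.mem_filter.2 ⟨hv, hwv⟩
  rw [h, Finset.mem_insert, Finset.mem_singleton] at this
  rcases this with rfl | rfl
  · exact Finset.mem_filter.2 ⟨hv, w, hwS, b, hb, hwv.symm, hab, hwb⟩
  · exact Finset.mem_filter.2 ⟨hv, w, hwS, a, ha, hwv.symm, hab.symm, hwa⟩

lemma filter_triangleVerts_adj (hP : PathFourFree G S) {w : V} (hw : w ∈ triangleVerts G S) :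
    (triangleVerts G S).filter (G.Adj w) = S.filter (G.Adj w) := by
  ext v
  simp only [Finset.mem_filter]
  exact ⟨fun h => ⟨(Finset.mem_filter.1 h.1).1, h.2⟩,
    fun h => ⟨mem_triangleVerts_of_adj hP hw h.1 h.2, h.2⟩⟩

lemma three_mul_degIn_triangleVerts_le (hP : PathFourFree G S) {z : V}
    (hz : ∀ a ∈ triangleVerts G S, ∀ b ∈ triangleVerts G S, G.Adj z a → G.Adj z b → ¬ G.Adj a b) :
    3 * degIn G (triangleVerts G S) z ≤ (triangleVerts G S).card := by
  set T := triangleVerts G S with hT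
  have h1 : (T.filter (G.Adj z)).card * 2 ≤ (T.filter fun v => ¬ G.Adj z v).card * 1 := by
    refine Finset.card_mul_le_card_mul G.Adj (fun a ha => ?_) fun b hb => ?_
    · rw [Finset.mem_filter] at ha
      rw [← degIn_of_mem_triangleVerts hP ha.1, degIn, ← filter_triangleVerts_adj hP ha.1]
      refine Finset.card_le_card fun v hv => ?_
      rw [Finset.mem_filter] at hv
      simp only [Finset.bipartiteAbove, Finset.mem_filter]
      exact ⟨⟨hv.1, fun hzv => hz a ha.1 v hv.1 ha.2 hzv hv.2⟩, hv.2⟩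
    · rw [Finset.mem_filter] at hb
      refine Finset.card_le_one.2 fun p hp q hq => ?_
      simp only [Finset.bipartiteBelow, Finset.mem_filter] at hp hq
      by_contra hpq
      obtain ⟨a, _, c, _, _, _, hac, h⟩ := filter_adj_of_mem_triangleVerts hP hb.1
      have hp' : p ∈ S.filter (G.Adj b) :=
        Finset.mem_filter.2 ⟨(Finset.mem_filter.1 hp.1.1).1, hp.2.symm⟩
      have hq' : q ∈ S.filter (G.Adj b) :=
        Finset.mem_filter.2 ⟨(Finset.mem_filter.1 hq.1.1).1, hq.2.symm⟩
      rw [h, Finset.mem_insert, Finset.mem_singleton] at hp' hq'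
      have := hz p hp.1.1 q hq.1.1 hp.1.2 hq.1.2
      rcases hp' with rfl | rfl <;> rcases hq' with rfl | rfl
      exacts [hpq rfl, this hac, this hac.symm, hpq rfl]
  have h2 := Finset.card_filter_add_card_filter_not (s := T) (G.Adj z)
  rw [degIn]
  omega

lemma three_le_card_triangleVerts (hP : PathFourFree G S) {w : V} (hw : w ∈ triangleVerts G S) :
    3 ≤ (triangleVerts G S).card := by
  obtain ⟨a, ha, b, hb, hwa, hwb, hab, -⟩ := filter_adj_of_mem_triangleVerts hP hw
  exact Finset.two_lt_card.2 ⟨w, hw, a, mem_triangleVerts_of_adj hP hw ha hwa, b,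
    mem_triangleVerts_of_adj hP hw hb hwb, hwa.ne, hwb.ne, hab.ne⟩

lemma degIn_eq_one_of_adj (hP : PathFourFree G S) {w v : V} (hw : w ∈ S)
    (hwT : w ∉ triangleVerts G S) (hd : 2 ≤ degIn G S w) (hv : v ∈ S) (hwv : G.Adj w v) :
    degIn G S v = 1 := by
  have hpos : 0 < degIn G S v := degIn_pos_iff.2 ⟨w, hw, hwv.symm⟩
  by_contra hne
  obtain ⟨v', hv', hvv', hv'w⟩ := exists_adj_ne_of_two_le_degIn w (show 2 ≤ degIn G S v by omega)
  obtain ⟨w', hw', hww', hw'v⟩ := exists_adj_ne_of_two_le_degIn v hd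
  refine hP hw' hw hv hv' hww'.symm hwv hvv' hw'v ?_ hv'w.symm
  rintro rfl
  exact hwT (Finset.mem_filter.2 ⟨hw, v, hv, w', hw', hwv, hww', hvv'⟩)

/-- The contribution to the spectral deficit of a nonempty union of star components. -/
lemma two_le_sum_of_stars (hP : PathFourFree G S) {x : V → ℝ} (hx1 : ∀ v, x v ≤ 1)
    {Q : Finset V} (hQ : Q.Nonempty) (hQS : Q ⊆ S)
    (hQcl : ∀ w ∈ Q, ∀ v ∈ S, G.Adj w v → v ∈ Q) (hQT : ∀ w ∈ Q, w ∉ triangleVerts G S)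
    (hQpos : ∀ w ∈ Q, 0 < degIn G S w) :
    2 ≤ ∑ w ∈ Q, ((degIn G S w : ℝ) - 2 * (degIn G S w - 1) * x w) := by
  set A := Q.filter fun w => 2 ≤ degIn G S w with hA
  set B := Q.filter fun w => ¬ 2 ≤ degIn G S w with hB
  have hBone : ∀ b ∈ B, degIn G S b = 1 := by
    intro b hb
    have h := Finset.mem_filter.1 hb
    have := hQpos b h.1
    omega
  have hAB : ∑ w ∈ A, degIn G S w ≤ B.card := by
    calc ∑ w ∈ A, degIn G S w ≤ ∑ w ∈ A, (B.bipartiteAbove G.Adj w).card := by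
          refine Finset.sum_le_sum fun w hw => Finset.card_le_card fun v hv => ?_
          rw [Finset.mem_filter] at hv hw
          have hvQ := hQcl w hw.1 v hv.1 hv.2
          have := degIn_eq_one_of_adj hP (hQS hw.1) (hQT w hw.1) hw.2 hv.1 hv.2
          simp only [Finset.bipartiteAbove, Finset.mem_filter, hB]
          exact ⟨⟨hvQ, by omega⟩, hv.2⟩
      _ = ∑ b ∈ B, (A.bipartiteBelow G.Adj b).card :=
          Finset.sum_card_bipartiteAbove_eq_sum_card_bipartiteBelow _
      _ ≤ ∑ b ∈ B, 1 := by
          refine Finset.sum_le_sum fun b hb => ?_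
          rw [← hBone b hb]
          refine Finset.card_le_card fun v hv => ?_
          simp only [Finset.bipartiteBelow, Finset.mem_filter, hA] at hv ⊢
          exact ⟨hQS hv.1.1, hv.2.symm⟩
      _ = B.card := by simp
  have hsumB : ∑ w ∈ B, ((degIn G S w : ℝ) - 2 * (degIn G S w - 1) * x w) = B.card := by
    rw [Finset.card_eq_sum_ones, Nat.cast_sum]
    refine Finset.sum_congr rfl fun b hb => ?_
    simp [hBone b hb]
  have hsumA : 2 * (A.card : ℝ) - ∑ w ∈ A, (degIn G S w : ℝ)
      ≤ ∑ w ∈ A, ((degIn G S w : ℝ) - 2 * (degIn G S w - 1) * x w) := by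
    rw [mul_comm, ← nsmul_eq_mul, ← Finset.sum_const, ← Finset.sum_sub_distrib]
    refine Finset.sum_le_sum fun w hw => ?_
    have h2 : (2 : ℝ) ≤ degIn G S w := by exact_mod_cast (Finset.mem_filter.1 hw).2
    nlinarith [hx1 w]
  have hABr : ∑ w ∈ A, (degIn G S w : ℝ) ≤ B.card := by exact_mod_cast hAB
  have htot : ∑ w ∈ Q, ((degIn G S w : ℝ) - 2 * (degIn G S w - 1) * x w) = _ :=
    (Finset.sum_filter_add_sum_filter_not Q (fun w => 2 ≤ degIn G S w) _).symm
  rw [← hA, ← hB] at htot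
  rw [htot, hsumB]
  rcases A.eq_empty_or_nonempty with hA0 | hAne
  · obtain ⟨b, hb⟩ := hQ
    have hQB : ∀ v ∈ Q, v ∈ B := by
      intro v hv
      by_contra h
      have : v ∈ A := Finset.mem_filter.2 ⟨hv, by
        by_contra h'
        exact h (Finset.mem_filter.2 ⟨hv, h'⟩)⟩
      simp [hA0] at this
    obtain ⟨v, hv, hbv⟩ := degIn_pos_iff.1 (hQpos b hb)
    have h1 : 1 < B.card :=
      Finset.one_lt_card.2 ⟨b, hQB b hb, v, hQB v (hQcl b hb v hv hbv), hbv.ne⟩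
    have h2 : (2 : ℝ) ≤ B.card := by exact_mod_cast h1
    simpa [hA0] using h2
  · have : (1 : ℝ) ≤ A.card := by exact_mod_cast hAne.card_pos
    linarith

end PathFourFree

/-- The vertices of `S` with no neighbour in `S`. -/
noncomputable def isolVerts {V : Type*} (G : SimpleGraph V) (S : Finset V) : Finset V :=
  S.filter fun w => degIn G S w = 0

/-- The vertices of `S` that have a neighbour in `S` but lie on no triangle inside `S`. -/
noncomputable def starVerts {V : Type*} (G : SimpleGraph V) (S : Finset V) : Finset V :=
  S.filter fun w => w ∉ triangleVerts G S ∧ 0 < degIn G S w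

section Decomposition

variable {V : Type*} {G : SimpleGraph V} {S : Finset V}

lemma mem_isolVerts {w : V} : w ∈ isolVerts G S ↔ w ∈ S ∧ degIn G S w = 0 :=
  Finset.mem_filter

lemma mem_starVerts {w : V} :
    w ∈ starVerts G S ↔ w ∈ S ∧ w ∉ triangleVerts G S ∧ 0 < degIn G S w :=
  Finset.mem_filter

lemma triangleVerts_subset : triangleVerts G S ⊆ S := Finset.filter_subset _ _

lemma degIn_pos_of_mem_triangleVerts {w : V} (hw : w ∈ triangleVerts G S) : 0 < degIn G S w := by
  obtain ⟨-, a, ha, -, -, hwa, -⟩ := Finset.mem_filter.1 hw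
  exact degIn_pos_iff.2 ⟨a, ha, hwa⟩

lemma sum_eq_triangleVerts_add_isolVerts_add_starVerts (f : V → ℝ) :
    ∑ v ∈ S, f v =
      ∑ v ∈ triangleVerts G S, f v + ∑ v ∈ isolVerts G S, f v + ∑ v ∈ starVerts G S, f v := by
  rw [← Finset.sum_union, ← Finset.sum_union]
  · congr 1
    ext v
    simp only [Finset.mem_union, mem_isolVerts, mem_starVerts]
    have := @triangleVerts_subset V G S v
    have : degIn G S v = 0 ∨ 0 < degIn G S v := Nat.eq_zero_or_pos _
    tauto
  · refine Finset.disjoint_left.2 fun v hv hv' => ?_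
    rw [mem_starVerts] at hv'
    rcases Finset.mem_union.1 hv with h | h
    · exact hv'.2.1 h
    · exact hv'.2.2.ne' (mem_isolVerts.1 h).2
  · exact Finset.disjoint_left.2 fun v hv hv' =>
      (degIn_pos_of_mem_triangleVerts hv).ne' (mem_isolVerts.1 hv').2

lemma sum_sum_filter_adj (A B : Finset V) (f : V → ℝ) :
    ∑ v ∈ A, ∑ w ∈ B.filter (G.Adj v), f w = ∑ w ∈ B, degIn G A w * f w := by
  simp_rw [Finset.sum_filter]
  rw [Finset.sum_comm]
  refine Finset.sum_congr rfl fun w _ => ?_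
  simp_rw [G.adj_comm _ w]
  rw [← Finset.sum_filter, Finset.sum_const, nsmul_eq_mul, degIn]

lemma sum_degIn_comm (A B : Finset V) :
    ∑ v ∈ A, (degIn G B v : ℝ) = ∑ w ∈ B, (degIn G A w : ℝ) := by
  have h := sum_sum_filter_adj (G := G) A B fun _ => 1
  simpa [degIn] using h

lemma two_mul_degIn_le_sum {z : V} (hz : z ∈ S) : 2 * degIn G S z ≤ ∑ w ∈ S, degIn G S w := by
  have h1 : degIn G S z ≤ ∑ w ∈ S.filter (G.Adj z), degIn G S w := by
    rw [degIn, Finset.card_eq_sum_ones]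
    exact Finset.sum_le_sum fun w hw =>
      degIn_pos_iff.2 ⟨z, hz, (Finset.mem_filter.1 hw).2.symm⟩
  have h2 : ∑ w ∈ insert z (S.filter (G.Adj z)), degIn G S w ≤ ∑ w ∈ S, degIn G S w :=
    Finset.sum_le_sum_of_subset (Finset.insert_subset hz (Finset.filter_subset _ _))
  rw [Finset.sum_insert (by simp)] at h2
  omega

variable [Fintype V]

lemma sum_univ_eq_add_neighborFinset_add_Wset (G : SimpleGraph V) (u : V) (f : V → ℝ) :
    ∑ v, f v = f u + ∑ v ∈ G.neighborFinset u, f v + ∑ v ∈ Wset G u, f v := by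
  rw [Wset, ← Finset.sum_insert (by simp), add_comm]
  exact (Finset.sum_sdiff (Finset.subset_univ _)).symm

lemma mem_Wset {u v : V} : v ∈ Wset G u ↔ v ≠ u ∧ ¬ G.Adj u v := by
  simp [Wset]

lemma sum_neighborFinset_eq (u v : V) (f : V → ℝ) :
    ∑ w ∈ G.neighborFinset v, f w = (if G.Adj v u then f u else 0) +
      ∑ w ∈ (G.neighborFinset u).filter (G.Adj v), f w + ∑ w ∈ (Wset G u).filter (G.Adj v), f w := by
  rw [neighborFinset_eq_filter, Finset.sum_filter, sum_univ_eq_add_neighborFinset_add_Wset G u,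
    ← Finset.sum_filter, ← Finset.sum_filter]

/-- The handshake identity for the partition into a vertex, its neighbours and the rest. -/
lemma two_mul_edgeCount_eq (u : V) :
    2 * (edgeCount G : ℝ) = 2 * (G.neighborFinset u).card +
      ∑ v ∈ G.neighborFinset u, (degIn G (G.neighborFinset u) v : ℝ) +
      2 * ∑ v ∈ Wset G u, (degIn G (G.neighborFinset u) v : ℝ) +
      ∑ v ∈ Wset G u, (degIn G (Wset G u) v : ℝ) := by
  have hdeg (v : V) : (G.degree v : ℝ) = (if G.Adj v u then 1 else 0) +
      degIn G (G.neighborFinset u) v + degIn G (Wset G u) v := by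
    have := sum_neighborFinset_eq (G := G) u v fun _ => 1
    simpa [degIn] using this
  have h := congrArg (Nat.cast (R := ℝ)) G.sum_degrees_eq_twice_card_edges
  push_cast at h
  rw [edgeCount, ← h, sum_univ_eq_add_neighborFinset_add_Wset G u]
  have hN : ∑ v ∈ G.neighborFinset u, (G.degree v : ℝ) = (G.neighborFinset u).card +
      ∑ v ∈ G.neighborFinset u, (degIn G (G.neighborFinset u) v : ℝ) +
      ∑ v ∈ G.neighborFinset u, (degIn G (Wset G u) v : ℝ) := by
    rw [Finset.card_eq_sum_ones, Nat.cast_sum, ← Finset.sum_add_distrib, ← Finset.sum_add_distrib]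
    refine Finset.sum_congr rfl fun v hv => ?_
    rw [hdeg, if_pos ((G.mem_neighborFinset _ _).1 hv).symm, Nat.cast_one]
  have hW : ∑ v ∈ Wset G u, (G.degree v : ℝ) =
      ∑ v ∈ Wset G u, (degIn G (G.neighborFinset u) v : ℝ) +
      ∑ v ∈ Wset G u, (degIn G (Wset G u) v : ℝ) := by
    rw [← Finset.sum_add_distrib]
    refine Finset.sum_congr rfl fun v hv => ?_
    rw [hdeg, if_neg fun h => (mem_Wset.1 hv).2 h.symm, zero_add]
  rw [hN, hW, sum_degIn_comm (G.neighborFinset u) (Wset G u), ← G.card_neighborFinset_eq_degree]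
  ring

end Decomposition

/-- `x` is a nonnegative `ρ`-eigenvector of `G` whose largest entry `1` is attained at `u`. -/
structure IsPerronPair {V : Type*} [Fintype V] (G : SimpleGraph V) (ρ : ℝ) (x : V → ℝ) (u : V) :
    Prop where
  nonneg : ∀ v, 0 ≤ x v
  le_one : ∀ v, x v ≤ 1
  apply_eq_one : x u = 1
  eigen : ∀ v, ρ * x v = ∑ w ∈ G.neighborFinset v, x w

namespace IsPerronPair

variable {V : Type*} [Fintype V] {G : SimpleGraph V} {ρ : ℝ} {x : V → ℝ} {u : V}

lemma sum_neighborFinset (h : IsPerronPair G ρ x u) : ∑ v ∈ G.neighborFinset u, x v = ρ := by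
  rw [← h.eigen, h.apply_eq_one, mul_one]

lemma eigen_of_adj (h : IsPerronPair G ρ x u) {v : V} (hv : G.Adj u v) :
    ρ * x v = 1 + ∑ w ∈ (G.neighborFinset u).filter (G.Adj v), x w +
      ∑ w ∈ (Wset G u).filter (G.Adj v), x w := by
  rw [h.eigen, sum_neighborFinset_eq u, if_pos hv.symm, h.apply_eq_one]

lemma eigen_of_mem_Wset (h : IsPerronPair G ρ x u) {v : V} (hv : v ∈ Wset G u) :
    ρ * x v = ∑ w ∈ (G.neighborFinset u).filter (G.Adj v), x w +
      ∑ w ∈ (Wset G u).filter (G.Adj v), x w := by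
  rw [h.eigen, sum_neighborFinset_eq u, if_neg fun h => (mem_Wset.1 hv).2 h.symm, zero_add]

lemma mul_sum_of_subset (h : IsPerronPair G ρ x u) {A : Finset V} (hA : A ⊆ G.neighborFinset u) :
    ρ * ∑ v ∈ A, x v = A.card + ∑ w ∈ G.neighborFinset u, degIn G A w * x w +
      ∑ w ∈ Wset G u, degIn G A w * x w := by
  rw [Finset.mul_sum, ← sum_sum_filter_adj, ← sum_sum_filter_adj, Finset.card_eq_sum_ones,
    Nat.cast_sum, ← Finset.sum_add_distrib, ← Finset.sum_add_distrib]
  refine Finset.sum_congr rfl fun v hv => ?_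
  rw [h.eigen_of_adj ((G.mem_neighborFinset _ _).1 (hA hv)), Nat.cast_one]

lemma deficit_eq (h : IsPerronPair G ρ x u) :
    2 * (edgeCount G : ℝ) - 2 * ρ ^ 2 + 2 * ρ =
      ∑ v ∈ G.neighborFinset u, ((degIn G (G.neighborFinset u) v : ℝ) -
        2 * (degIn G (G.neighborFinset u) v - 1) * x v) +
      2 * ∑ v ∈ Wset G u, degIn G (G.neighborFinset u) v * (1 - x v) +
      ∑ v ∈ Wset G u, (degIn G (Wset G u) v : ℝ) := by
  have h1 := h.mul_sum_of_subset (Finset.Subset.refl _)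
  have h2 := h.sum_neighborFinset
  have h3 : ∑ v ∈ G.neighborFinset u, ((degIn G (G.neighborFinset u) v : ℝ) -
        2 * (degIn G (G.neighborFinset u) v - 1) * x v) =
      ∑ v ∈ G.neighborFinset u, (degIn G (G.neighborFinset u) v : ℝ) -
        2 * ∑ v ∈ G.neighborFinset u, degIn G (G.neighborFinset u) v * x v +
        2 * ∑ v ∈ G.neighborFinset u, x v := by
    rw [Finset.mul_sum, Finset.mul_sum, ← Finset.sum_sub_distrib, ← Finset.sum_add_distrib]
    exact Finset.sum_congr rfl fun v _ => by ring
  have h4 : ∑ v ∈ Wset G u, degIn G (G.neighborFinset u) v * (1 - x v) =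
      ∑ v ∈ Wset G u, (degIn G (G.neighborFinset u) v : ℝ) -
        ∑ v ∈ Wset G u, degIn G (G.neighborFinset u) v * x v := by
    rw [← Finset.sum_sub_distrib]
    exact Finset.sum_congr rfl fun v _ => by ring
  rw [h3, h4, two_mul_edgeCount_eq u]
  rw [h2] at h1 ⊢
  linear_combination -2 * h1

end IsPerronPair

section PathFourFree

variable {V : Type*} {G : SimpleGraph V} {S : Finset V}

lemma mem_starVerts_of_adj (hP : PathFourFree G S) {w v : V} (hw : w ∈ starVerts G S) (hv : v ∈ S)
    (hwv : G.Adj w v) : v ∈ starVerts G S := by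
  rw [mem_starVerts] at hw ⊢
  exact ⟨hv, fun hvT => hw.2.1 (mem_triangleVerts_of_adj hP hvT hw.1 hwv.symm),
    degIn_pos_iff.2 ⟨w, hw.1, hwv.symm⟩⟩

lemma exists_star_center (hP : PathFourFree G S) (hne : (starVerts G S).Nonempty) :
    ∃ c ∈ starVerts G S, ∀ l ∈ S, G.Adj c l → degIn G S l = 1 := by
  obtain ⟨c, hc, hmax⟩ := Finset.exists_max_image _ (degIn G S) hne
  refine ⟨c, hc, fun l hl hcl => ?_⟩
  have hc' := mem_starVerts.1 hc
  have hlS := mem_starVerts_of_adj hP hc hl hcl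
  by_cases h : 2 ≤ degIn G S c
  · exact degIn_eq_one_of_adj hP hc'.1 hc'.2.1 h hl hcl
  · have h1 := hmax l hlS
    have h2 := (mem_starVerts.1 hlS).2.2
    omega

lemma sum_star_eq {c : V} (hl : ∀ l ∈ S, G.Adj c l → degIn G S l = 1) (x : V → ℝ) :
    ∑ w ∈ insert c (S.filter (G.Adj c)), ((degIn G S w : ℝ) - 2 * (degIn G S w - 1) * x w) =
      2 + 2 * ((degIn G S c - 1) * (1 - x c)) := by
  have h1 : ∑ w ∈ S.filter (G.Adj c), ((degIn G S w : ℝ) - 2 * (degIn G S w - 1) * x w) =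
      degIn G S c := by
    rw [degIn, Finset.card_eq_sum_ones, Nat.cast_sum]
    refine Finset.sum_congr rfl fun w hw => ?_
    rw [Finset.mem_filter] at hw
    simp [hl w hw.1 hw.2]
  rw [Finset.sum_insert (by simp), h1]
  ring

lemma starVerts_eq_or_four_le (hP : PathFourFree G S) {x : V → ℝ} (hx1 : ∀ v, x v ≤ 1) {c : V}
    (hc : c ∈ starVerts G S) (hl : ∀ l ∈ S, G.Adj c l → degIn G S l = 1) :
    starVerts G S = insert c (S.filter (G.Adj c)) ∨
      4 ≤ ∑ w ∈ starVerts G S, ((degIn G S w : ℝ) - 2 * (degIn G S w - 1) * x w) := by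
  set star := insert c (S.filter (G.Adj c)) with hstar
  have hsub : star ⊆ starVerts G S := by
    refine Finset.insert_subset hc fun l hl' => ?_
    rw [Finset.mem_filter] at hl'
    exact mem_starVerts_of_adj hP hc hl'.1 hl'.2
  rcases (starVerts G S \ star).eq_empty_or_nonempty with h | h
  · exact Or.inl (Finset.Subset.antisymm (Finset.sdiff_eq_empty_iff_subset.1 h) hsub)
  · right
    have h1 := two_le_sum_of_stars hP hx1 h
      (fun w hw => (mem_starVerts.1 (Finset.mem_sdiff.1 hw).1).1) ?_
      (fun w hw => (mem_starVerts.1 (Finset.mem_sdiff.1 hw).1).2.1)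
      (fun w hw => (mem_starVerts.1 (Finset.mem_sdiff.1 hw).1).2.2)
    · have h2 := sum_star_eq hl x
      have h3 : (1 : ℝ) ≤ degIn G S c := by exact_mod_cast (mem_starVerts.1 hc).2.2
      rw [← Finset.sum_sdiff hsub, h2]
      nlinarith [hx1 c]
    · intro w hw v hv hwv
      rw [Finset.mem_sdiff] at hw ⊢
      refine ⟨mem_starVerts_of_adj hP hw.1 hv hwv, fun hvs => hw.2 ?_⟩
      have hwS := (mem_starVerts.1 hw.1).1
      rcases Finset.mem_insert.1 hvs with rfl | hvL
      · exact Finset.mem_insert_of_mem (Finset.mem_filter.2 ⟨hwS, hwv.symm⟩)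
      · rw [Finset.mem_filter] at hvL
        have hcard : (S.filter (G.Adj v)).card ≤ 1 := (hl v hvL.1 hvL.2).le
        rw [Finset.card_le_one.1 hcard w (Finset.mem_filter.2 ⟨hwS, hwv.symm⟩) c
          (Finset.mem_filter.2 ⟨(mem_starVerts.1 hc).1, hvL.2.symm⟩)]
        exact Finset.mem_insert_self _ _

lemma sum_degIn_triangleVerts_mul (hP : PathFourFree G S) (x : V → ℝ) :
    ∑ w ∈ S, degIn G (triangleVerts G S) w * x w = 2 * ∑ w ∈ triangleVerts G S, x w := by
  rw [Finset.mul_sum, ← Finset.sum_subset triangleVerts_subset]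
  · refine Finset.sum_congr rfl fun w hw => ?_
    rw [degIn, filter_triangleVerts_adj hP hw, ← degIn, degIn_of_mem_triangleVerts hP hw]
    norm_num
  · intro w hw hwT
    have : degIn G (triangleVerts G S) w = 0 := by
      by_contra h
      obtain ⟨v, hv, hwv⟩ := degIn_pos_iff.1 (Nat.pos_of_ne_zero h)
      exact hwT (mem_triangleVerts_of_adj hP hv hw hwv.symm)
    simp [this]

lemma degIn_mono {A B : Finset V} (hAB : A ⊆ B) (v : V) : degIn G A v ≤ degIn G B v :=
  Finset.card_le_card (Finset.filter_subset_filter _ hAB)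

lemma sum_filter_adj_le_degIn {x : V → ℝ} (hx1 : ∀ v, x v ≤ 1) (A : Finset V) (v : V) :
    ∑ w ∈ A.filter (G.Adj v), x w ≤ degIn G A v := by
  rw [degIn, ← nsmul_one, ← Finset.sum_const]
  exact Finset.sum_le_sum fun w _ => hx1 w

lemma three_mul_degIn_triangleVerts_le_of_mem_Wset [Fintype V]
    (hgf : ¬ ContainsCopy gem G) {u z : V} (hz : z ∈ Wset G u) :
    3 * degIn G (triangleVerts G (G.neighborFinset u)) z ≤
      (triangleVerts G (G.neighborFinset u)).card := by
  have hP := pathFourFree_neighborFinset hgf u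
  refine three_mul_degIn_triangleVerts_le hP fun a ha b hb hza hzb hab => ?_
  rw [mem_Wset] at hz
  obtain ⟨p, hp, q, hq, hap, haq, hpq, hfilter⟩ := filter_adj_of_mem_triangleVerts hP ha
  have hau := (G.mem_neighborFinset _ _).1 (triangleVerts_subset ha)
  have hbu := (G.mem_neighborFinset _ _).1 (triangleVerts_subset hb)
  rw [mem_neighborFinset] at hp hq
  have hb' : b ∈ (G.neighborFinset u).filter (G.Adj a) :=
    Finset.mem_filter.2 ⟨triangleVerts_subset hb, hab⟩
  rw [hfilter, Finset.mem_insert, Finset.mem_singleton] at hb'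
  have key (c : V) (hc : G.Adj u c) (hac : G.Adj a c) (hbc : b ≠ c) : False :=
    false_of_gemFree hgf hza.symm hab hau.symm hac hzb hbu.symm hc hz.1
      (fun h => hz.2 (h ▸ hc)) hbc
  rcases hb' with rfl | rfl
  · exact key q hq haq hpq.ne
  · exact key p hp hap hpq.ne'

end PathFourFree

namespace IsPerronPair

variable {V : Type*} [Fintype V] {G : SimpleGraph V} {ρ : ℝ} {x : V → ℝ} {u : V}

/-- The spectral deficit, split according to the components of the neighbourhood of `u`. -/
lemma deficit_eq_components (h : IsPerronPair G ρ x u) (hgf : ¬ ContainsCopy gem G) :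
    2 * ((edgeCount G : ℝ) - ρ ^ 2 + ρ) =
      2 * ((triangleVerts G (G.neighborFinset u)).card -
        ∑ v ∈ triangleVerts G (G.neighborFinset u), x v) +
      2 * ∑ v ∈ isolVerts G (G.neighborFinset u), x v +
      ∑ v ∈ starVerts G (G.neighborFinset u), ((degIn G (G.neighborFinset u) v : ℝ) -
        2 * (degIn G (G.neighborFinset u) v - 1) * x v) +
      2 * ∑ v ∈ Wset G u, degIn G (G.neighborFinset u) v * (1 - x v) +
      ∑ v ∈ Wset G u, (degIn G (Wset G u) v : ℝ) := by
  have hP := pathFourFree_neighborFinset hgf u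
  have h1 := h.deficit_eq
  rw [sum_eq_triangleVerts_add_isolVerts_add_starVerts (G := G)] at h1
  have hT : ∑ v ∈ triangleVerts G (G.neighborFinset u), ((degIn G (G.neighborFinset u) v : ℝ) -
      2 * (degIn G (G.neighborFinset u) v - 1) * x v) =
      2 * ((triangleVerts G (G.neighborFinset u)).card -
        ∑ v ∈ triangleVerts G (G.neighborFinset u), x v) := by
    rw [Finset.card_eq_sum_ones, Nat.cast_sum, ← Finset.sum_sub_distrib, Finset.mul_sum]
    refine Finset.sum_congr rfl fun v hv => ?_
    rw [degIn_of_mem_triangleVerts hP hv]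
    push_cast
    ring
  have hZ : ∑ v ∈ isolVerts G (G.neighborFinset u), ((degIn G (G.neighborFinset u) v : ℝ) -
      2 * (degIn G (G.neighborFinset u) v - 1) * x v) =
      2 * ∑ v ∈ isolVerts G (G.neighborFinset u), x v := by
    rw [Finset.mul_sum]
    refine Finset.sum_congr rfl fun v hv => ?_
    rw [(mem_isolVerts.1 hv).2]
    push_cast
    ring
  rw [hT, hZ] at h1
  linear_combination h1

lemma sum_le_card (h : IsPerronPair G ρ x u) (S : Finset V) :
    ∑ v ∈ S, x v ≤ S.card := by
  rw [← nsmul_one, ← Finset.sum_const]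
  exact Finset.sum_le_sum fun v _ => h.le_one v

lemma sum_nonneg (h : IsPerronPair G ρ x u) (S : Finset V) : 0 ≤ ∑ v ∈ S, x v :=
  Finset.sum_nonneg fun v _ => h.nonneg v

lemma sub_two_mul_sum_triangleVerts (h : IsPerronPair G ρ x u) (hgf : ¬ ContainsCopy gem G) :
    (ρ - 2) * ∑ v ∈ triangleVerts G (G.neighborFinset u), x v =
      (triangleVerts G (G.neighborFinset u)).card +
        ∑ w ∈ Wset G u, degIn G (triangleVerts G (G.neighborFinset u)) w * x w := by
  have h1 := h.mul_sum_of_subset (triangleVerts_subset (G := G) (S := G.neighborFinset u))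
  rw [sum_degIn_triangleVerts_mul (pathFourFree_neighborFinset hgf u)] at h1
  linear_combination h1

lemma cost_nonneg (h : IsPerronPair G ρ x u) (A : Finset V) (v : V) :
    0 ≤ degIn G A v * (1 - x v) :=
  mul_nonneg (Nat.cast_nonneg _) (sub_nonneg.2 (h.le_one v))

lemma cost_le (h : IsPerronPair G ρ x u) {z : V} (hz : z ∈ Wset G u) :
    degIn G (G.neighborFinset u) z * (1 - x z) ≤
      ∑ v ∈ Wset G u, degIn G (G.neighborFinset u) v * (1 - x v) :=
  Finset.single_le_sum (f := fun v => (degIn G (G.neighborFinset u) v : ℝ) * (1 - x v))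
    (fun v _ => h.cost_nonneg _ v) hz

/-- If every vertex outside the closed neighbourhood of `u` has a small entry, then few edges
leave the triangles in the neighbourhood of `u`. -/
lemma mul_sum_degIn_triangleVerts_le (h : IsPerronPair G ρ x u) {κ : ℝ}
    (hκ : ∀ z ∈ Wset G u, κ * x z ≤ 1 - x z) :
    κ * ∑ w ∈ Wset G u, degIn G (triangleVerts G (G.neighborFinset u)) w * x w ≤
      ∑ v ∈ Wset G u, degIn G (G.neighborFinset u) v * (1 - x v) := by
  rw [Finset.mul_sum]
  refine Finset.sum_le_sum fun z hz => ?_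
  have h1 : (degIn G (triangleVerts G (G.neighborFinset u)) z : ℝ) ≤
      degIn G (G.neighborFinset u) z := by
    exact_mod_cast degIn_mono triangleVerts_subset z
  calc κ * (degIn G (triangleVerts G (G.neighborFinset u)) z * x z)
      = degIn G (triangleVerts G (G.neighborFinset u)) z * (κ * x z) := by ring
    _ ≤ degIn G (triangleVerts G (G.neighborFinset u)) z * (1 - x z) :=
        mul_le_mul_of_nonneg_left (hκ z hz) (Nat.cast_nonneg _)
    _ ≤ _ := mul_le_mul_of_nonneg_right h1 (sub_nonneg.2 (h.le_one z))

lemma starVerts_nonempty (h : IsPerronPair G ρ x u) (hgf : ¬ ContainsCopy gem G) (hρ : 5 < ρ)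
    (hm : (edgeCount G : ℝ) - 2 < ρ ^ 2 - ρ) : (starVerts G (G.neighborFinset u)).Nonempty := by
  rw [Finset.nonempty_iff_ne_empty]
  intro hS
  have hdef := h.deficit_eq_components hgf
  have hsum := h.sum_neighborFinset
  have hX := h.sub_two_mul_sum_triangleVerts hgf
  rw [sum_eq_triangleVerts_add_isolVerts_add_starVerts (G := G)] at hsum
  rw [hS, Finset.sum_empty] at hdef hsum
  have ha := h.sum_le_card (triangleVerts G (G.neighborFinset u))
  have hb := h.sum_nonneg (isolVerts G (G.neighborFinset u))
  have hC := Finset.sum_nonneg fun v (_ : v ∈ Wset G u) =>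
    h.cost_nonneg (G.neighborFinset u) v
  have hκ := h.mul_sum_degIn_triangleVerts_le (κ := 4 / 11) fun z hz => by
    have h1 : (3 * degIn G (triangleVerts G (G.neighborFinset u)) z : ℝ) ≤
        (triangleVerts G (G.neighborFinset u)).card := by
      exact_mod_cast three_mul_degIn_triangleVerts_le_of_mem_Wset hgf hz
    have h2 : (2 * degIn G (Wset G u) z : ℝ) ≤ ∑ w ∈ Wset G u, (degIn G (Wset G u) w : ℝ) := by
      exact_mod_cast two_mul_degIn_le_sum hz
    have h3 := h.eigen_of_mem_Wset hz
    have h4 := sum_filter_adj_le_degIn (G := G) h.le_one (Wset G u) z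
    have h5 : ∑ w ∈ (G.neighborFinset u).filter (G.Adj z), x w ≤
        degIn G (triangleVerts G (G.neighborFinset u)) z +
          ∑ v ∈ isolVerts G (G.neighborFinset u), x v := by
      rw [Finset.sum_filter, sum_eq_triangleVerts_add_isolVerts_add_starVerts (G := G), hS,
        Finset.sum_empty, add_zero, ← Finset.sum_filter, ← Finset.sum_filter]
      exact add_le_add (sum_filter_adj_le_degIn h.le_one _ _)
        (Finset.sum_le_sum_of_subset_of_nonneg (Finset.filter_subset _ _)
          fun v _ _ => h.nonneg v)
    have h6 : ρ * x z ≤ ρ / 3 + 2 := by linarith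
    nlinarith
  have he : 0 ≤ ∑ w ∈ Wset G u, (degIn G (Wset G u) w : ℝ) :=
    Finset.sum_nonneg fun _ _ => Nat.cast_nonneg _
  have hT : ∑ v ∈ triangleVerts G (G.neighborFinset u), x v =
      ρ - ∑ v ∈ isolVerts G (G.neighborFinset u), x v := by linarith
  rw [hT] at hX hdef ha
  have hb2 : ∑ v ∈ isolVerts G (G.neighborFinset u), x v < 2 := by linarith
  nlinarith [mul_pos (sub_pos.2 hρ) (sub_pos.2 hb2)]

end IsPerronPair

/-- The part of the neighbourhood of `u` without triangles and isolated vertices is a star with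
centre `c`, and the remaining contributions to the spectral deficit are small. -/
structure IsStarCenter {V : Type*} [Fintype V] (G : SimpleGraph V) (x : V → ℝ) (u c : V) :
    Prop where
  mem_starVerts : c ∈ starVerts G (G.neighborFinset u)
  degIn_eq_one : ∀ l ∈ G.neighborFinset u, G.Adj c l → degIn G (G.neighborFinset u) l = 1
  starVerts_eq : starVerts G (G.neighborFinset u) = insert c ((G.neighborFinset u).filter (G.Adj c))
  degIn_Wset : ∀ z ∈ Wset G u, degIn G (Wset G u) z = 0
  deficit_lt : (degIn G (G.neighborFinset u) c - 1) * (1 - x c) +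
    ((triangleVerts G (G.neighborFinset u)).card -
      ∑ v ∈ triangleVerts G (G.neighborFinset u), x v) +
    ∑ v ∈ isolVerts G (G.neighborFinset u), x v +
    ∑ v ∈ Wset G u, degIn G (G.neighborFinset u) v * (1 - x v) < 1

namespace IsStarCenter

variable {V : Type*} [Fintype V] {G : SimpleGraph V} {ρ : ℝ} {x : V → ℝ} {u c : V}

lemma adj (hc : IsStarCenter G x u c) : G.Adj u c :=
  (G.mem_neighborFinset _ _).1 (_root_.mem_starVerts.1 hc.mem_starVerts).1

lemma one_le_degIn (hc : IsStarCenter G x u c) : (1 : ℝ) ≤ degIn G (G.neighborFinset u) c := by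
  exact_mod_cast (_root_.mem_starVerts.1 hc.mem_starVerts).2.2

lemma one_le_degIn_of_mem_Wset (hc : IsStarCenter G x u c) (hniso : ∀ v, ∃ w, G.Adj v w) {z : V}
    (hz : z ∈ Wset G u) : 1 ≤ degIn G (G.neighborFinset u) z := by
  obtain ⟨w, hzw⟩ := hniso z
  refine degIn_pos_iff.2 ⟨w, ?_, hzw⟩
  by_contra hw
  rw [mem_neighborFinset] at hw
  have hwu : w ≠ u := by
    rintro rfl
    exact (mem_Wset.1 hz).2 hzw.symm
  exact (degIn_pos_iff.2 ⟨w, mem_Wset.2 ⟨hwu, hw⟩, hzw⟩).ne' (hc.degIn_Wset z hz)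

lemma mul_apply_of_mem_Wset (h : IsPerronPair G ρ x u) (hc : IsStarCenter G x u c) {z : V}
    (hz : z ∈ Wset G u) : ρ * x z = ∑ w ∈ (G.neighborFinset u).filter (G.Adj z), x w := by
  have h0 : (Wset G u).filter (G.Adj z) = ∅ := Finset.card_eq_zero.1 (hc.degIn_Wset z hz)
  rw [h.eigen_of_mem_Wset hz, h0, Finset.sum_empty, add_zero]

lemma mul_apply_le (h : IsPerronPair G ρ x u) (hc : IsStarCenter G x u c) {z : V}
    (hz : z ∈ Wset G u) : ρ * x z ≤ degIn G (G.neighborFinset u) z :=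
  (mul_apply_of_mem_Wset h hc hz).trans_le (sum_filter_adj_le_degIn h.le_one _ _)

lemma mul_one_sub_apply (h : IsPerronPair G ρ x u) (hc : IsStarCenter G x u c) {z : V}
    (hz : z ∈ Wset G u) :
    ρ * (1 - x z) = ∑ w ∈ (G.neighborFinset u).filter (fun w => ¬ G.Adj z w), x w := by
  have h1 := Finset.sum_filter_add_sum_filter_not (G.neighborFinset u) (G.Adj z) x
  rw [h.sum_neighborFinset, ← mul_apply_of_mem_Wset h hc hz] at h1
  linear_combination -h1

lemma triangleVerts_eq_empty (h : IsPerronPair G ρ x u) (hc : IsStarCenter G x u c)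
    (hgf : ¬ ContainsCopy gem G) (hρ : 5 < ρ) (hniso : ∀ v, ∃ w, G.Adj v w) :
    triangleVerts G (G.neighborFinset u) = ∅ := by
  rw [Finset.eq_empty_iff_forall_notMem]
  intro w hw
  have hdef := hc.deficit_lt
  have hT3 : (3 : ℝ) ≤ (triangleVerts G (G.neighborFinset u)).card := by
    exact_mod_cast three_le_card_triangleVerts (pathFourFree_neighborFinset hgf u) hw
  have ha := h.sum_le_card (triangleVerts G (G.neighborFinset u))
  have hb := h.sum_nonneg (isolVerts G (G.neighborFinset u))
  have hX := h.sub_two_mul_sum_triangleVerts hgf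
  have hC := Finset.sum_nonneg fun v (_ : v ∈ Wset G u) =>
    h.cost_nonneg (G.neighborFinset u) v
  have hstar := mul_nonneg (sub_nonneg.2 hc.one_le_degIn) (sub_nonneg.2 (h.le_one c))
  have hκ := h.mul_sum_degIn_triangleVerts_le (κ := 4) fun z hz => by
    have hcost := h.cost_le hz
    have hle := mul_apply_le h hc hz
    rcases (hc.one_le_degIn_of_mem_Wset hniso hz).eq_or_lt with hd | hd
    · rw [← hd, Nat.cast_one] at hle
      nlinarith [h.nonneg z]
    · exfalso
      have hd2 : (2 : ℝ) ≤ degIn G (G.neighborFinset u) z := by exact_mod_cast hd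
      have hxz : 1 / 2 < x z := by nlinarith [h.le_one z]
      have h3 : (3 * degIn G (triangleVerts G (G.neighborFinset u)) z : ℝ) ≤
          (triangleVerts G (G.neighborFinset u)).card := by
        exact_mod_cast three_mul_degIn_triangleVerts_le_of_mem_Wset hgf hz
      have hmiss : ∑ w ∈ (triangleVerts G (G.neighborFinset u)).filter (fun w => ¬ G.Adj z w), x w
          ≤ ρ * (1 - x z) := by
        rw [mul_one_sub_apply h hc hz]
        exact Finset.sum_le_sum_of_subset_of_nonneg
          (Finset.filter_subset_filter _ triangleVerts_subset) fun v _ _ => h.nonneg v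
      have hsplit := Finset.sum_filter_add_sum_filter_not
        (triangleVerts G (G.neighborFinset u)) (G.Adj z) x
      have hadj := sum_filter_adj_le_degIn (G := G) h.le_one
        (triangleVerts G (G.neighborFinset u)) z
      have hmiss' : 2 - ((triangleVerts G (G.neighborFinset u)).card -
          ∑ v ∈ triangleVerts G (G.neighborFinset u), x v) ≤ ρ * (1 - x z) := by linarith
      have h5 := mul_le_mul_of_nonneg_right hle (sub_nonneg.2 (h.le_one z))
      have h6 := mul_le_mul_of_nonneg_left hmiss' (h.nonneg z)
      have h7 : 0 < 2 - ((triangleVerts G (G.neighborFinset u)).card -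
          ∑ v ∈ triangleVerts G (G.neighborFinset u), x v) := by linarith
      have h8 := mul_pos (sub_pos.2 hxz) h7
      linarith
  have h1 := mul_nonneg (sub_nonneg.2 hρ.le)
    (h.sum_nonneg (triangleVerts G (G.neighborFinset u)))
  linarith

lemma sum_neighborFinset_eq_add (hc : IsStarCenter G x u c)
    (hT : triangleVerts G (G.neighborFinset u) = ∅) (f : V → ℝ) :
    ∑ v ∈ G.neighborFinset u, f v = ∑ v ∈ isolVerts G (G.neighborFinset u), f v + f c +
      ∑ v ∈ (G.neighborFinset u).filter (G.Adj c), f v := by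
  rw [sum_eq_triangleVerts_add_isolVerts_add_starVerts (G := G), hT, Finset.sum_empty,
    hc.starVerts_eq, Finset.sum_insert (by simp)]
  ring

lemma mem_neighborFinset_cases (hc : IsStarCenter G x u c)
    (hT : triangleVerts G (G.neighborFinset u) = ∅) {v : V} (hv : v ∈ G.neighborFinset u) :
    v = c ∨ G.Adj c v ∨ v ∈ isolVerts G (G.neighborFinset u) := by
  rcases Nat.eq_zero_or_pos (degIn G (G.neighborFinset u) v) with h0 | h0
  · exact Or.inr (Or.inr (mem_isolVerts.2 ⟨hv, h0⟩))
  · have : v ∈ starVerts G (G.neighborFinset u) :=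
      _root_.mem_starVerts.2 ⟨hv, by simp [hT], h0⟩
    rw [hc.starVerts_eq, Finset.mem_insert, Finset.mem_filter] at this
    tauto

lemma four_le_degIn (h : IsPerronPair G ρ x u) (hc : IsStarCenter G x u c) (hρ : 5 < ρ)
    (hT : triangleVerts G (G.neighborFinset u) = ∅) : 4 ≤ degIn G (G.neighborFinset u) c := by
  have hdef := hc.deficit_lt
  rw [hT, Finset.sum_empty, Finset.card_empty, Nat.cast_zero] at hdef
  have hsum := h.sum_neighborFinset
  rw [hc.sum_neighborFinset_eq_add hT] at hsum
  have hstar := mul_nonneg (sub_nonneg.2 hc.one_le_degIn) (sub_nonneg.2 (h.le_one c))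
  have hC := Finset.sum_nonneg fun v (_ : v ∈ Wset G u) =>
    h.cost_nonneg (G.neighborFinset u) v
  have hL := sum_filter_adj_le_degIn (G := G) h.le_one (G.neighborFinset u) c
  have h3 : (3 : ℝ) < degIn G (G.neighborFinset u) c := by linarith [h.le_one c]
  exact_mod_cast h3

/-- A vertex outside the closed neighbourhood of `u` with at least two neighbours in it. -/
lemma bounds_of_two_le_degIn (h : IsPerronPair G ρ x u) (hc : IsStarCenter G x u c)
    (hgf : ¬ ContainsCopy gem G) (hρ : 5 < ρ) (hT : triangleVerts G (G.neighborFinset u) = ∅)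
    {z : V} (hz : z ∈ Wset G u) (hd : 2 ≤ degIn G (G.neighborFinset u) z) :
    ¬ G.Adj z c ∧ 18 / 25 < x z ∧ 17 / 20 < x c ∧ x c ≤ ρ * (1 - x z) := by
  have hdef := hc.deficit_lt
  rw [hT, Finset.sum_empty, Finset.card_empty, Nat.cast_zero] at hdef
  have hb := h.sum_nonneg (isolVerts G (G.neighborFinset u))
  have hr := hc.four_le_degIn h hρ hT
  have hr' : (4 : ℝ) ≤ degIn G (G.neighborFinset u) c := by exact_mod_cast hr
  have hd' : (2 : ℝ) ≤ degIn G (G.neighborFinset u) z := by exact_mod_cast hd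
  have hstar : 3 * (1 - x c) ≤ (degIn G (G.neighborFinset u) c - 1) * (1 - x c) :=
    mul_le_mul_of_nonneg_right (by linarith) (sub_nonneg.2 (h.le_one c))
  have hcost := h.cost_le hz
  have hle := mul_apply_le h hc hz
  have hxz : 1 / 2 < x z := by nlinarith [h.le_one z, h.le_one c]
  have hzu := mem_Wset.1 hz
  have hzc : ¬ G.Adj z c := by
    intro hzc
    have hsub : (G.neighborFinset u).filter (G.Adj z) ⊆
        insert c (isolVerts G (G.neighborFinset u)) := by
      intro l hl
      rw [Finset.mem_filter] at hl
      rcases hc.mem_neighborFinset_cases hT hl.1 with rfl | hcl | hlZ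
      · exact Finset.mem_insert_self _ _
      · exfalso
        obtain ⟨l', hl', hcl', hne⟩ := exists_adj_ne_of_two_le_degIn l 
          (show 2 ≤ degIn G (G.neighborFinset u) c by omega)
        rw [mem_neighborFinset] at hl' hl
        exact false_of_gemFree hgf hzc.symm hcl hc.adj.symm hcl' hl.2 hl.1.symm hl' hzu.1
          (fun h => hzu.2 (h ▸ hl')) hne.symm
      · exact Finset.mem_insert_of_mem hlZ
    have h1 := Finset.sum_le_sum_of_subset_of_nonneg hsub fun v _ _ => h.nonneg v
    have hcZ : c ∉ isolVerts G (G.neighborFinset u) := fun hcZ =>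
      (_root_.mem_starVerts.1 hc.mem_starVerts).2.2.ne' (mem_isolVerts.1 hcZ).2
    rw [Finset.sum_insert hcZ, ← mul_apply_of_mem_Wset h hc hz] at h1
    nlinarith [h.le_one c, h.le_one z]
  have hmiss : x c ≤ ρ * (1 - x z) := by
    rw [mul_one_sub_apply h hc hz]
    exact Finset.single_le_sum (fun v _ => h.nonneg v)
      (Finset.mem_filter.2 ⟨(_root_.mem_starVerts.1 hc.mem_starVerts).1, hzc⟩)
  have h5 := mul_le_mul_of_nonneg_right hle (sub_nonneg.2 (h.le_one z))
  have hxz' : 18 / 25 < x z := by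
    by_contra! hlt
    nlinarith [h.le_one z, h.le_one c, mul_nonneg (sub_nonneg.2 hlt) (sub_nonneg.2 hxz.le),
      mul_pos (sub_pos.2 hρ) (mul_pos (show 0 < x z by linarith)
        (show 0 < 1 - x z by linarith))]
  refine ⟨hzc, hxz', ?_, hmiss⟩
  have h6 := mul_le_mul_of_nonneg_left hmiss (h.nonneg z)
  nlinarith [h.nonneg c]

lemma half_lt_cost (h : IsPerronPair G ρ x u) (hc : IsStarCenter G x u c)
    (hgf : ¬ ContainsCopy gem G) (hρ : 5 < ρ) (hT : triangleVerts G (G.neighborFinset u) = ∅)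
    (hniso : ∀ v, ∃ w, G.Adj v w) {z : V} (hz : z ∈ Wset G u) :
    1 / 2 < degIn G (G.neighborFinset u) z * (1 - x z) := by
  have hle := mul_apply_le h hc hz
  rcases (hc.one_le_degIn_of_mem_Wset hniso hz).eq_or_lt with hd | hd
  · rw [← hd, Nat.cast_one] at hle ⊢
    nlinarith [h.nonneg z]
  · obtain ⟨-, h1, h2, h3⟩ := hc.bounds_of_two_le_degIn h hgf hρ hT hz hd
    have h5 := mul_le_mul_of_nonneg_right hle (sub_nonneg.2 (h.le_one z))
    nlinarith

lemma card_Wset_le_one (h : IsPerronPair G ρ x u) (hc : IsStarCenter G x u c)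
    (hgf : ¬ ContainsCopy gem G) (hρ : 5 < ρ) (hT : triangleVerts G (G.neighborFinset u) = ∅)
    (hniso : ∀ v, ∃ w, G.Adj v w) : (Wset G u).card ≤ 1 := by
  have hdef := hc.deficit_lt
  rw [hT, Finset.sum_empty, Finset.card_empty, Nat.cast_zero] at hdef
  have hb := h.sum_nonneg (isolVerts G (G.neighborFinset u))
  have hstar := mul_nonneg (sub_nonneg.2 hc.one_le_degIn) (sub_nonneg.2 (h.le_one c))
  have h1 := Finset.card_nsmul_le_sum (Wset G u)
    (fun v => (degIn G (G.neighborFinset u) v : ℝ) * (1 - x v)) (1 / 2)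
    fun z hz => (half_lt_cost h hc hgf hρ hT hniso hz).le
  rw [nsmul_eq_mul] at h1
  have h2 : ((Wset G u).card : ℝ) < 2 := by linarith
  have h3 : (Wset G u).card < 2 := by exact_mod_cast h2
  omega

/-- The edge count when the neighbourhood of `u` has no triangle. -/
lemma edgeCount_eq (hc : IsStarCenter G x u c) (hT : triangleVerts G (G.neighborFinset u) = ∅) :
    (edgeCount G : ℝ) = 1 + 2 * degIn G (G.neighborFinset u) c +
      (isolVerts G (G.neighborFinset u)).card +
      ∑ v ∈ Wset G u, (degIn G (G.neighborFinset u) v : ℝ) := by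
  have h1 := two_mul_edgeCount_eq (G := G) u
  have hW : ∑ v ∈ Wset G u, (degIn G (Wset G u) v : ℝ) = 0 :=
    Finset.sum_eq_zero fun v hv => by rw [hc.degIn_Wset v hv, Nat.cast_zero]
  have hZ : ∑ v ∈ isolVerts G (G.neighborFinset u), (degIn G (G.neighborFinset u) v : ℝ) = 0 :=
    Finset.sum_eq_zero fun v hv => by rw [(mem_isolVerts.1 hv).2, Nat.cast_zero]
  have hL : ∑ v ∈ (G.neighborFinset u).filter (G.Adj c), (degIn G (G.neighborFinset u) v : ℝ) =
      degIn G (G.neighborFinset u) c := by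
    rw [degIn, Finset.card_eq_sum_ones, Nat.cast_sum]
    refine Finset.sum_congr rfl fun v hv => ?_
    rw [Finset.mem_filter] at hv
    rw [hc.degIn_eq_one v hv.1 hv.2]
  have hcard := hc.sum_neighborFinset_eq_add hT fun _ => 1
  rw [hc.sum_neighborFinset_eq_add hT, hW, hZ, hL] at h1
  simp only [Finset.sum_const, nsmul_eq_mul, mul_one] at hcard
  rw [← degIn] at hcard
  linear_combination h1 / 2 + hcard

lemma Wset_eq_empty (h : IsPerronPair G ρ x u) (hc : IsStarCenter G x u c)
    (hgf : ¬ ContainsCopy gem G) (hρ : 5 < ρ) (hT : triangleVerts G (G.neighborFinset u) = ∅)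
    (hniso : ∀ v, ∃ w, G.Adj v w) (hodd : Odd (edgeCount G)) : Wset G u = ∅ := by
  rw [Finset.eq_empty_iff_forall_notMem]
  intro z hz
  have hW1 := card_Wset_le_one h hc hgf hρ hT hniso
  have hWz : Wset G u = {z} :=
    Finset.eq_singleton_iff_unique_mem.2 ⟨hz, fun y hy => Finset.card_le_one.1 hW1 y hy z hz⟩
  have hdef := hc.deficit_lt
  rw [hT, Finset.sum_empty, Finset.card_empty, Nat.cast_zero] at hdef
  have hb := h.sum_nonneg (isolVerts G (G.neighborFinset u))
  have hstar := mul_nonneg (sub_nonneg.2 hc.one_le_degIn) (sub_nonneg.2 (h.le_one c))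
  have hcost := h.cost_le hz
  have hle := mul_apply_le h hc hz
  have hρ0 : 0 < ρ := by linarith
  rcases (hc.one_le_degIn_of_mem_Wset hniso hz).eq_or_lt with hd | hd
  · have hZ : isolVerts G (G.neighborFinset u) = ∅ := by
      rw [Finset.eq_empty_iff_forall_notMem]
      intro w hw
      have h1 : 1 ≤ ρ * x w := by
        rw [h.eigen_of_adj ((G.mem_neighborFinset _ _).1 (mem_isolVerts.1 hw).1)]
        linarith [h.sum_nonneg ((G.neighborFinset u).filter (G.Adj w)),
          h.sum_nonneg ((Wset G u).filter (G.Adj w))]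
      have h2 : x w ≤ ∑ v ∈ isolVerts G (G.neighborFinset u), x v :=
        Finset.single_le_sum (fun v _ => h.nonneg v) hw
      rw [← hd, Nat.cast_one] at hle hcost
      nlinarith
    have hm := hc.edgeCount_eq hT
    rw [hZ, hWz, Finset.sum_singleton, ← hd] at hm
    have hm' : edgeCount G = 1 + 2 * degIn G (G.neighborFinset u) c + 1 := by
      have : (edgeCount G : ℝ) = ((1 + 2 * degIn G (G.neighborFinset u) c + 1 : ℕ) : ℝ) := by
        rw [hm]
        push_cast
        simp
      exact_mod_cast this
    obtain ⟨k, hk⟩ := hodd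
    omega
  · obtain ⟨hzc, h1, h2, h3⟩ := hc.bounds_of_two_le_degIn h hgf hρ hT hz hd
    have hnbr : ρ * (ρ * x z) ≤ degIn G (G.neighborFinset u) z * 3 := by
      rw [mul_apply_of_mem_Wset h hc hz, degIn, Finset.mul_sum, ← nsmul_eq_mul]
      refine Finset.sum_le_card_nsmul _ _ _ fun l hl => ?_
      rw [Finset.mem_filter] at hl
      have hdl : (degIn G (G.neighborFinset u) l : ℝ) ≤ 1 := by
        rcases hc.mem_neighborFinset_cases hT hl.1 with rfl | hcl | hlZ
        · exact absurd hl.2 hzc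
        · rw [hc.degIn_eq_one l hl.1 hcl, Nat.cast_one]
        · rw [(mem_isolVerts.1 hlZ).2]
          simp
      have hWl : (degIn G (Wset G u) l : ℝ) ≤ 1 := by
        exact_mod_cast (Finset.card_filter_le _ _).trans hW1
      rw [h.eigen_of_adj ((G.mem_neighborFinset _ _).1 hl.1)]
      linarith [sum_filter_adj_le_degIn (G := G) h.le_one (G.neighborFinset u) l,
        sum_filter_adj_le_degIn (G := G) h.le_one (Wset G u) l]
    have h4 := mul_le_mul_of_nonneg_right hnbr (sub_nonneg.2 (h.le_one z))
    have h5 : 5 * (18 / 25) * (17 / 20) ≤ ρ * x z * (ρ * (1 - x z)) := by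
      have : 5 * (18 / 25) ≤ ρ * x z := by nlinarith
      exact mul_le_mul this (by linarith) (by norm_num) (by positivity)
    linarith

end IsStarCenter

lemma IsPerronPair.exists_isStarCenter {V : Type*} [Fintype V] {G : SimpleGraph V} {ρ : ℝ}
    {x : V → ℝ} {u : V} (h : IsPerronPair G ρ x u) (hgf : ¬ ContainsCopy gem G) (hρ : 5 < ρ)
    (hm : (edgeCount G : ℝ) - 2 < ρ ^ 2 - ρ) : ∃ c, IsStarCenter G x u c := by
  have hP := pathFourFree_neighborFinset hgf u
  obtain ⟨c, hc, hl⟩ := exists_star_center hP (h.starVerts_nonempty hgf hρ hm)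
  have hdef := h.deficit_eq_components hgf
  have ha := h.sum_le_card (triangleVerts G (G.neighborFinset u))
  have hb := h.sum_nonneg (isolVerts G (G.neighborFinset u))
  have hC := Finset.sum_nonneg fun v (_ : v ∈ Wset G u) =>
    h.cost_nonneg (G.neighborFinset u) v
  have he : 0 ≤ ∑ w ∈ Wset G u, (degIn G (Wset G u) w : ℝ) :=
    Finset.sum_nonneg fun _ _ => Nat.cast_nonneg _
  have heq : starVerts G (G.neighborFinset u) =
      insert c ((G.neighborFinset u).filter (G.Adj c)) := by
    refine (starVerts_eq_or_four_le hP h.le_one hc hl).resolve_right fun h4 => ?_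
    linarith
  rw [heq, sum_star_eq hl] at hdef
  have h1 : (1 : ℝ) ≤ degIn G (G.neighborFinset u) c := by
    exact_mod_cast (mem_starVerts.1 hc).2.2
  have hstar := mul_nonneg (sub_nonneg.2 h1) (sub_nonneg.2 (h.le_one c))
  refine ⟨c, hc, hl, heq, fun z hz => ?_, by linarith⟩
  have h2 : (2 * degIn G (Wset G u) z : ℝ) ≤ ∑ w ∈ Wset G u, (degIn G (Wset G u) w : ℝ) := by
    exact_mod_cast two_mul_degIn_le_sum hz
  have h3 : (degIn G (Wset G u) z : ℝ) < 1 := by linarith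
  have h4 : degIn G (Wset G u) z < 1 := by exact_mod_cast h3
  omega

namespace IsStarCenter

variable {V : Type*} [Fintype V] {G : SimpleGraph V} {ρ : ℝ} {x : V → ℝ} {u c : V}

lemma nonempty_iso (hc : IsStarCenter G x u c) (hT : triangleVerts G (G.neighborFinset u) = ∅)
    (hW : Wset G u = ∅) :
    Nonempty (G ≃g pendantS (degIn G (G.neighborFinset u) c)
      (isolVerts G (G.neighborFinset u)).card) := by
  have hiso : ∀ p ∈ isolVerts G (G.neighborFinset u), ∀ v ∈ G.neighborFinset u, ¬ G.Adj p v :=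
    fun p hp v hv hpv => (degIn_pos_iff.2 ⟨v, hv, hpv⟩).ne' (mem_isolVerts.1 hp).2
  have hcN := (_root_.mem_starVerts.1 hc.mem_starVerts).1
  have hsub (p) (hp : p ∈ isolVerts G (G.neighborFinset u)) := (mem_isolVerts.1 hp).1
  refine nonempty_iso_pendantS (u := u) (c := c) (L := (G.neighborFinset u).filter (G.Adj c))
    (fun v => ?_) hc.adj (fun l hl => ?_) (fun l hl => (Finset.mem_filter.1 hl).2) (fun p hp => ?_)
    (fun p hp hcp => hiso p hp c hcN hcp.symm) (fun hcZ => ?_) (fun l hl l' hl' hll' => ?_)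
    (fun l hl p hp hlp => hiso p hp l (Finset.mem_filter.1 hl).1 hlp.symm)
    fun p hp p' hp' => hiso p hp p' (hsub p' hp')
  · by_cases hvu : v = u
    · exact Or.inl hvu
    have hv : v ∈ G.neighborFinset u := by
      rw [mem_neighborFinset]
      by_contra h
      simpa [hW] using mem_Wset.2 ⟨hvu, h⟩
    have := hc.mem_neighborFinset_cases hT hv
    rw [Finset.mem_filter]
    tauto
  · exact (G.mem_neighborFinset _ _).1 (Finset.mem_filter.1 hl).1
  · exact (G.mem_neighborFinset _ _).1 (hsub p hp)
  · exact (_root_.mem_starVerts.1 hc.mem_starVerts).2.2.ne' (mem_isolVerts.1 hcZ).2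
  · rw [Finset.mem_filter] at hl hl'
    have h1 : (_ : Finset V).card ≤ 1 := (hc.degIn_eq_one l hl.1 hl.2).le
    have h2 := Finset.card_le_one.1 h1 c (Finset.mem_filter.2 ⟨hcN, hl.2.symm⟩) l'
      (Finset.mem_filter.2 ⟨hl'.1, hll'⟩)
    exact hl'.2.ne h2

/-- The characteristic equation of `ρ` when `u` is adjacent to every other vertex. -/
lemma characteristic_eq (h : IsPerronPair G ρ x u) (hc : IsStarCenter G x u c)
    (hT : triangleVerts G (G.neighborFinset u) = ∅) (hW : Wset G u = ∅) :
    ρ ^ 4 - (1 + 2 * degIn G (G.neighborFinset u) c + (isolVerts G (G.neighborFinset u)).card) *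
      ρ ^ 2 - 2 * degIn G (G.neighborFinset u) c * ρ +
      degIn G (G.neighborFinset u) c * (isolVerts G (G.neighborFinset u)).card = 0 := by
  have hcN := (_root_.mem_starVerts.1 hc.mem_starVerts).1
  have hsum := h.sum_neighborFinset
  rw [hc.sum_neighborFinset_eq_add hT] at hsum
  have hxc := h.eigen_of_adj hc.adj
  rw [hW, Finset.filter_empty, Finset.sum_empty, add_zero] at hxc
  have hZ : ρ * ∑ v ∈ isolVerts G (G.neighborFinset u), x v =
      (isolVerts G (G.neighborFinset u)).card := by
    rw [Finset.mul_sum, Finset.card_eq_sum_ones, Nat.cast_sum]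
    refine Finset.sum_congr rfl fun v hv => ?_
    rw [mem_isolVerts] at hv
    have h0 : (G.neighborFinset u).filter (G.Adj v) = ∅ := Finset.card_eq_zero.1 hv.2
    rw [h.eigen_of_adj ((G.mem_neighborFinset _ _).1 hv.1), hW, h0]
    simp
  have hL : ρ * ∑ v ∈ (G.neighborFinset u).filter (G.Adj c), x v =
      degIn G (G.neighborFinset u) c * (1 + x c) := by
    rw [Finset.mul_sum, degIn, ← nsmul_eq_mul]
    refine Finset.sum_eq_card_nsmul fun l hl => ?_
    rw [Finset.mem_filter] at hl
    have h1 : (G.neighborFinset u).filter (G.Adj l) = {c} := by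
      obtain ⟨y, hy⟩ := Finset.card_eq_one.1 (hc.degIn_eq_one l hl.1 hl.2)
      have : c ∈ (G.neighborFinset u).filter (G.Adj l) := Finset.mem_filter.2 ⟨hcN, hl.2.symm⟩
      rw [hy, Finset.mem_singleton] at this
      rw [hy, this]
    rw [h.eigen_of_adj ((G.mem_neighborFinset _ _).1 hl.1), hW, h1]
    simp
  set r : ℝ := ((degIn G (G.neighborFinset u) c : ℕ) : ℝ)
  set k : ℝ := (((isolVerts G (G.neighborFinset u)).card : ℕ) : ℝ)
  have e1 : ρ ^ 2 - r - k = x c * (ρ + r) := by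
    linear_combination -ρ * hsum + hZ + hL
  have e2 : x c * (ρ ^ 2 - r) = ρ + r := by
    linear_combination ρ * hxc + hL
  linear_combination (ρ ^ 2 - r) * e1 + (ρ + r) * e2

end IsStarCenter

/-- A graph of large spectral radius is the graph `pendantS s 2`. -/
lemma IsPerronPair.nonempty_iso_pendantS {V : Type*} [Fintype V] {G : SimpleGraph V} {ρ : ℝ}
    {x : V → ℝ} {u : V} (h : IsPerronPair G ρ x u) (hgf : ¬ ContainsCopy gem G)
    (hniso : ∀ v, ∃ w, G.Adj v w) {s : ℕ} (hs : edgeCount G = 2 * s + 3)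
    (hbook : ¬ Nonempty (G ≃g bookS (s + 1))) (hρ : 5 < ρ) (hρs : 2 * s + 1 < ρ ^ 2 - ρ)
    (hf : 0 ≤ ρ ^ 4 - (2 * s + 3) * ρ ^ 2 - 2 * s * ρ + 2 * s) :
    Nonempty (G ≃g pendantS s 2) := by
  obtain ⟨c, hc⟩ := h.exists_isStarCenter hgf hρ (by rw [hs]; push_cast; linarith)
  have hT := hc.triangleVerts_eq_empty h hgf hρ hniso
  have hW := hc.Wset_eq_empty h hgf hρ hT hniso ⟨s + 1, by omega⟩
  have hiso := hc.nonempty_iso hT hW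
  have hchar := hc.characteristic_eq h hT hW
  have hm := hc.edgeCount_eq hT
  rw [hW, Finset.sum_empty, add_zero, hs] at hm
  have hr := _root_.mem_starVerts.1 hc.mem_starVerts |>.2.2
  generalize degIn G (G.neighborFinset u) c = r at *
  generalize (isolVerts G (G.neighborFinset u)).card = k at *
  have hm' : 2 * s + 3 = 1 + 2 * r + k := by exact_mod_cast hm
  obtain ⟨j, rfl⟩ : ∃ j, k = 2 * j := ⟨s + 1 - r, by omega⟩
  obtain rfl | rfl | hj : j = 0 ∨ j = 1 ∨ 2 ≤ j := by omega
  · obtain rfl : r = s + 1 := by omega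
    exact absurd (hiso.elim fun e => (pendantS_zero_iso_bookS _).map fun e' => e.trans e') hbook
  · obtain rfl : r = s := by omega
    exact hiso
  · exfalso
    obtain rfl : s = r + j - 1 := by omega
    have hj' : (2 : ℝ) ≤ j := by exact_mod_cast hj
    have hr' : (1 : ℝ) ≤ r := by exact_mod_cast hr
    rw [Nat.cast_sub (by omega)] at hf
    push_cast at hf hchar
    nlinarith [mul_nonneg (sub_nonneg.2 hj') (sub_nonneg.2 hr'),
      mul_nonneg (sub_nonneg.2 hj') (sub_nonneg.2 hρ.le)]

theorem stmt17 {V : Type*} [Fintype V] (G : SimpleGraph V) (m : ℕ)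
    (hodd : Odd m) (hm : 23 ≤ m)
    (hgf : ¬ ContainsCopy gem G) (hcard : edgeCount G = m)
    (hniso : ∀ v : V, ∃ w, G.Adj v w)
    (hnotS : ¬ Nonempty (G ≃g bookS ((m - 1) / 2))) :
    specRad G ≤ specRad (pendantS ((m - 3) / 2) 2) ∧
      (specRad G = specRad (pendantS ((m - 3) / 2) 2) ↔
        Nonempty (G ≃g pendantS ((m - 3) / 2) 2)) := by
  obtain ⟨s, rfl⟩ : ∃ s, m = 2 * s + 3 := by
    obtain ⟨k, rfl⟩ := hodd
    exact ⟨k - 1, by omega⟩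
  rw [show (2 * s + 3 - 1) / 2 = s + 1 by omega] at hnotS
  rw [show (2 * s + 3 - 3) / 2 = s by omega]
  have hmain : specRad (pendantS s 2) ≤ specRad G → Nonempty (G ≃g pendantS s 2) := by
    intro hle
    obtain ⟨μ, hμ, hμ5, hμs, hroot⟩ := exists_root_le_specRad_pendantS_two (s := s) (by omega)
    have hμρ : μ ≤ specRad G := hμ.trans hle
    have hne : Nonempty V := by
      by_contra hV
      rw [not_nonempty_iff] at hV
      have : edgeCount G = 0 := by
        rw [edgeCount, Finset.card_eq_zero, Finset.eq_empty_iff_forall_notMem]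
        intro e
        exact isEmptyElim e.out.1
      omega
    obtain ⟨x, u, h0, h1, hu, heig⟩ := exists_perron_vector G
    refine IsPerronPair.nonempty_iso_pendantS ⟨h0, h1, hu, heig⟩ hgf hniso hcard hnotS
      (by linarith) (by nlinarith) ?_
    set ρ := specRad G
    have hfac : ρ ^ 4 - (2 * s + 3) * ρ ^ 2 - 2 * s * ρ + 2 * s = (ρ - μ) *
        ((ρ + μ) * (ρ ^ 2 + μ ^ 2 - (2 * s + 3)) - 2 * s) := by
      linear_combination hroot
    rw [hfac]
    refine mul_nonneg (by linarith) ?_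
    have h2 : μ ^ 2 ≤ ρ ^ 2 := by nlinarith
    nlinarith
  refine ⟨not_lt.1 fun hlt => ?_, fun h => hmain h.ge, fun ⟨e⟩ => specRad_congr e⟩
  obtain ⟨e⟩ := hmain hlt.le
  exact hlt.ne' (specRad_congr e)
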